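/- arXiv:1211.1439 — 8 statements merged into one kernel-verified Lean document; each statement's English description precedes it below -/
import Mathlib

section
/- Let b ∈ ℝ^{s×m} be a matrix of rank n, let H = [H₁ H₂] ∈ ℝ^{m×m} be an orthogonal matrix with H₁ ∈ ℝ^{m×c}, and let c_y := rank(b·H₁). Then c_y ≤ min(n, c) and there exist an invertible matrix T_y ∈ ℝ^{s×s}, an invertible matrix T ∈ ℝ^{m×m} whose last m−c rows equal H₂ᵀ, and a matrix B ∈ ℝ^{(s−c_y)×(m−c)} with rank(B) = n−c_y, such that T_y · b · T⁻¹ equals the 2×3 block matrix [[I_{c_y}, 0, 0],[0, 0, B]], where the block column widths are c_y, c−c_y and m−c and the block row heights are c_y and s−c_y. -/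
open Matrix

namespace Matrix

variable {K : Type*} [Field K] {α β γ ρ : Type*} [Fintype β] [Fintype γ]

/-- The rank of a block diagonal matrix is the sum of the ranks of its blocks. -/
theorem rank_fromBlocks_zero_zero (X : Matrix α β K) (Y : Matrix ρ γ K) :
    (fromBlocks X 0 0 Y).rank = X.rank + Y.rank := by
  have key : (LinearEquiv.sumArrowLequivProdArrow α ρ K K).toLinearMap ∘ₗ
      (fromBlocks X 0 0 Y).mulVecLin =
      (X.mulVecLin.prodMap Y.mulVecLin) ∘ₗ
        (LinearEquiv.sumArrowLequivProdArrow β γ K K).toLinearMap := by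
    refine LinearMap.ext fun v => Prod.ext (funext fun i => ?_) (funext fun i => ?_)
    · change (fromBlocks X 0 0 Y *ᵥ v) (Sum.inl i) = (X *ᵥ (v ∘ Sum.inl)) i
      simp [fromBlocks_mulVec]
    · change (fromBlocks X 0 0 Y *ᵥ v) (Sum.inr i) = (Y *ᵥ (v ∘ Sum.inr)) i
      simp [fromBlocks_mulVec]
  have hmap : (LinearMap.range (fromBlocks X 0 0 Y).mulVecLin).map
      (LinearEquiv.sumArrowLequivProdArrow α ρ K K).toLinearMap =
      (LinearMap.range X.mulVecLin).prod (LinearMap.range Y.mulVecLin) := by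
    rw [← LinearMap.range_comp, key, LinearMap.range_comp, LinearEquiv.range, Submodule.map_top,
      LinearMap.range_prodMap]
  let ι := (LinearMap.range X.mulVecLin).subtype.prodMap (LinearMap.range Y.mulVecLin).subtype
  have hι : Function.Injective ι :=
    Function.Injective.prodMap (Submodule.injective_subtype _) (Submodule.injective_subtype _)
  have hιr : LinearMap.range ι =
      (LinearMap.range X.mulVecLin).prod (LinearMap.range Y.mulVecLin) := by
    simp only [ι, LinearMap.range_prodMap, Submodule.range_subtype]
  rw [rank, ← LinearEquiv.finrank_map_eq (LinearEquiv.sumArrowLequivProdArrow α ρ K K), hmap,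
    ← hιr, LinearMap.finrank_range_of_inj hι, Module.finrank_prod, rank, rank]

variable [Fintype α] [Fintype ρ]

/-- Rank normal form of a rectangular matrix over a field. -/
theorem exists_mul_mul_eq_fromBlocks_one [DecidableEq α] [DecidableEq β] [DecidableEq ρ]
    (A : Matrix (ρ ⊕ α) (ρ ⊕ β) K) (hA : A.rank = Fintype.card ρ) :
    ∃ (P : Matrix (ρ ⊕ α) (ρ ⊕ α) K) (Q : Matrix (ρ ⊕ β) (ρ ⊕ β) K),
      IsUnit P ∧ IsUnit Q ∧ P * A * Q = fromBlocks 1 0 0 0 := by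
  set f := A.mulVecLin with hf
  obtain ⟨C, hC⟩ := (LinearMap.ker f).exists_isCompl
  obtain ⟨D, hD⟩ := (LinearMap.range f).exists_isCompl
  have hrange : Module.finrank K (LinearMap.range f) = Fintype.card ρ := hA
  have hker : Module.finrank K (LinearMap.ker f) = Fintype.card β := by
    have := f.finrank_range_add_finrank_ker
    simp only [Module.finrank_fintype_fun_eq_card, Fintype.card_sum] at this
    omega
  have hDr : Module.finrank K D = Fintype.card α := by
    have := Submodule.finrank_add_eq_of_isCompl hD
    simp only [Module.finrank_fintype_fun_eq_card, Fintype.card_sum] at this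
    omega
  let g : C ≃ₗ[K] LinearMap.range f := f.kerComplementEquivRange hC.symm
  have hCr : Module.finrank K C = Fintype.card ρ := g.finrank_eq.trans hrange
  let u : Module.Basis ρ K C :=
    (Module.finBasisOfFinrankEq K C hCr).reindex (Fintype.equivFin ρ).symm
  let k : Module.Basis β K (LinearMap.ker f) :=
    (Module.finBasisOfFinrankEq K _ hker).reindex (Fintype.equivFin β).symm
  let d : Module.Basis α K D :=
    (Module.finBasisOfFinrankEq K D hDr).reindex (Fintype.equivFin α).symm
  let v := (u.prod k).map (Submodule.prodEquivOfIsCompl _ _ hC.symm)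
  let w := ((u.map g).prod d).map (Submodule.prodEquivOfIsCompl _ _ hD)
  have hvl (i : ρ) : f (v (Sum.inl i)) = w (Sum.inl i) := by
    simp [v, w, g]
  have hvr (i : β) : f (v (Sum.inr i)) = 0 := by
    simp [v]
  refine ⟨w.toMatrix (Pi.basisFun K _), (Pi.basisFun K _).toMatrix v, ?_, ?_, ?_⟩
  · exact IsUnit.of_mul_eq_one _ (w.toMatrix_mul_toMatrix_flip _)
  · exact IsUnit.of_mul_eq_one _ ((Pi.basisFun K _).toMatrix_mul_toMatrix_flip v)
  · have hA' : A = LinearMap.toMatrix (Pi.basisFun K _) (Pi.basisFun K _) f :=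
      (LinearMap.toMatrix'_toLin' A).symm
    rw [hA', basis_toMatrix_mul_linearMap_toMatrix_mul_basis_toMatrix]
    ext i (j | j)
    · rw [LinearMap.toMatrix_apply, hvl, Module.Basis.repr_self]
      rcases i with i | i <;> simp [Finsupp.single_apply, one_apply, eq_comm]
    · rw [LinearMap.toMatrix_apply, hvr]
      rcases i with i | i <;> simp

/-- If the first column block of `A` has rank `card ρ`, then invertible row operations, together
with column operations whose inverse fixes the last coordinates, bring `A` into the block form
`[[1, 0, 0], [0, 0, B]]`. -/
theorem exists_mul_mul_eq_fromBlocks_fromCols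
    [DecidableEq α] [DecidableEq β] [DecidableEq γ] [DecidableEq ρ]
    (A : Matrix (ρ ⊕ α) ((ρ ⊕ β) ⊕ γ) K) (hA : A.toCols₁.rank = Fintype.card ρ) :
    ∃ (P : Matrix (ρ ⊕ α) (ρ ⊕ α) K) (U V : Matrix ((ρ ⊕ β) ⊕ γ) ((ρ ⊕ β) ⊕ γ) K)
      (B : Matrix α γ K),
      IsUnit P ∧ U * V = 1 ∧ V * U = 1 ∧ U.toRows₂ = fromCols 0 1 ∧
      P * A * V = fromBlocks (fromCols 1 0) 0 0 B := by
  obtain ⟨P, Q, hP, hQ, hPQ⟩ := exists_mul_mul_eq_fromBlocks_one A.toCols₁ hA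
  let E : Matrix (ρ ⊕ α) γ K := P * A.toCols₂
  let X : Matrix (ρ ⊕ β) γ K := fromRows E.toRows₁ 0
  have hdet := (isUnit_iff_isUnit_det Q).1 hQ
  let V : Matrix ((ρ ⊕ β) ⊕ γ) ((ρ ⊕ β) ⊕ γ) K := fromBlocks Q (-(Q * X)) 0 1
  have hVU : V * fromBlocks Q⁻¹ X 0 1 = 1 := by
    simp [V, fromBlocks_multiply, mul_nonsing_inv Q hdet]
  refine ⟨P, fromBlocks Q⁻¹ X 0 1, V, E.toRows₂, hP,
    mul_eq_one_comm.1 hVU, hVU, ?_, ?_⟩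
  · ext i (j | j) <;> rfl
  · have hX : fromBlocks (1 : Matrix ρ ρ K) 0 0 (0 : Matrix α β K) * X =
        fromRows E.toRows₁ 0 := by
      simp [X, fromBlocks_mul_fromRows]
    have hsplit : P * A * V =
        fromCols (P * A.toCols₁ * Q) (E - P * A.toCols₁ * Q * X) := by
      conv_lhs => rw [← fromCols_toCols A, mul_fromCols, fromCols_mul_fromBlocks]
      simp [E, Matrix.mul_assoc, sub_eq_neg_add]
    rw [hsplit, hPQ, hX]
    ext (i | i) ((j | j) | j) <;> simp [toRows₁, toRows₂]

theorem rank_fromCols_one_zero [DecidableEq ρ] :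
    (fromCols (1 : Matrix ρ ρ K) (0 : Matrix ρ β K)).rank = Fintype.card ρ := by
  refine le_antisymm (rank_le_card_height _) ?_
  have := rank_submatrix_le (fromCols (1 : Matrix ρ ρ K) (0 : Matrix ρ β K)) id Sum.inl
  rwa [show (fromCols (1 : Matrix ρ ρ K) (0 : Matrix ρ β K)).submatrix id Sum.inl = 1 from rfl,
    rank_one] at this

end Matrix

/-- representation theorem core (Theorem 1(II) of the paper).
`b` is an `s × m` real matrix of rank `n`, `H` is orthogonal with first block
`H₁` consisting of its first `c` columns, and `c_y` is the rank of `b ⬝ H₁`.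
Then `c_y ≤ min n c` and there are invertible `T_y`, `T` (with the last `m − c`
rows of `T` equal to `H₂ᵀ`) and a matrix `B` of rank `n − c_y` bringing
`T_y ⬝ b ⬝ T⁻¹` into the canonical block form `[[I, 0, 0], [0, 0, B]]`. -/
theorem stmt0 (s m c n : ℕ) (hc : c ≤ m)
    (b : Matrix (Fin s) (Fin m) ℝ) (hb : b.rank = n)
    (H : Matrix (Fin m) (Fin m) ℝ) (hH : Hᵀ * H = 1)
    (c_y : ℕ)
    (hcy : c_y = (b * H.submatrix id (fun j : Fin c => Fin.castLE hc j)).rank) :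
    c_y ≤ min n c ∧
    ∃ (Ty : Matrix (Fin s) (Fin s) ℝ) (Tr Tinv : Matrix (Fin m) (Fin m) ℝ)
      (B : Matrix (Fin (s - c_y)) (Fin (m - c)) ℝ),
      IsUnit Ty ∧ Tr * Tinv = 1 ∧ Tinv * Tr = 1 ∧
      (∀ (j : Fin (m - c)) (i : Fin m),
        Tr ⟨c + j.1, by have := j.isLt; omega⟩ i = H i ⟨c + j.1, by have := j.isLt; omega⟩) ∧
      B.rank = n - c_y ∧
      (∀ (i : Fin s) (j : Fin m),
        (Ty * b * Tinv) i j =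
          if i.1 < c_y ∧ j.1 < c_y then (if i.1 = j.1 then 1 else 0)
          else if h2 : c_y ≤ i.1 ∧ c ≤ j.1 then
            B ⟨i.1 - c_y, by have := i.isLt; omega⟩ ⟨j.1 - c, by have := j.isLt; omega⟩
          else 0) := by
  have hHdet : IsUnit H.det := isUnit_det_of_left_inverse hH
  have hsub : b * H.submatrix id (fun j : Fin c => Fin.castLE hc j) =
      (b * H).submatrix id (fun j : Fin c => Fin.castLE hc j) := rfl
  rw [hsub] at hcy
  have hrn : c_y ≤ n := by
    rw [hcy, ← hb, ← rank_mul_eq_left_of_isUnit_det H b hHdet]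
    exact rank_submatrix_le _ _ _
  have hrc : c_y ≤ c := by
    rw [hcy]
    exact (rank_le_card_width _).trans_eq (Fintype.card_fin c)
  have hrs : c_y ≤ s := by
    rw [hcy]
    exact (rank_le_card_height _).trans_eq (Fintype.card_fin s)
  refine ⟨le_min hrn hrc, ?_⟩
  let es : Fin c_y ⊕ Fin (s - c_y) ≃ Fin s :=
    finSumFinEquiv.trans (finCongr (Nat.add_sub_cancel' hrs))
  let ec : Fin c_y ⊕ Fin (c - c_y) ≃ Fin c :=
    finSumFinEquiv.trans (finCongr (Nat.add_sub_cancel' hrc))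
  let em : (Fin c_y ⊕ Fin (c - c_y)) ⊕ Fin (m - c) ≃ Fin m :=
    ((Equiv.sumCongr ec (Equiv.refl _)).trans finSumFinEquiv).trans
      (finCongr (Nat.add_sub_cancel' hc))
  have hA : ((b * H).submatrix es em).toCols₁.rank = Fintype.card (Fin c_y) := by
    rw [Fintype.card_fin]
    conv_rhs => rw [hcy, ← rank_submatrix _ es ec]
    rfl
  obtain ⟨P, U, V, B, hP, hUV, hVU, hU, hPV⟩ :=
    exists_mul_mul_eq_fromBlocks_fromCols ((b * H).submatrix es em) hA
  have hmain : P.submatrix es.symm es.symm * b * (H * V.submatrix em.symm em.symm) =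
      (fromBlocks (fromCols 1 0) 0 0 B).submatrix es.symm em.symm := by
    rw [← hPV, ← submatrix_mul_equiv _ _ _ em.symm, ← submatrix_mul_equiv _ _ _ es.symm]
    simp [Matrix.mul_assoc]
  have hPu : IsUnit (P.submatrix es.symm es.symm) := by
    rw [isUnit_iff_isUnit_det] at hP ⊢
    rwa [det_submatrix_equiv_self]
  have hUV' : U.submatrix em.symm em.symm * Hᵀ * (H * V.submatrix em.symm em.symm) = 1 := by
    rw [Matrix.mul_assoc, ← Matrix.mul_assoc Hᵀ, hH, Matrix.one_mul, submatrix_mul_equiv, hUV,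
      submatrix_one_equiv]
  have hVU' := mul_eq_one_comm.1 hUV'
  refine ⟨P.submatrix es.symm es.symm, U.submatrix em.symm em.symm * Hᵀ,
    H * V.submatrix em.symm em.symm, B, hPu, hUV', hVU', ?_, ?_, ?_⟩
  · intro j i
    have hj : (⟨c + j.1, by have := j.isLt; omega⟩ : Fin m) = em (Sum.inr j) := rfl
    have hrow (k) : U (Sum.inr j) k = (1 : Matrix ((Fin c_y ⊕ Fin (c - c_y)) ⊕ Fin (m - c)) _ ℝ) (Sum.inr j) k := by
      refine (congrFun (congrFun hU j) k).trans ?_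
      rcases k with k | k <;> simp [one_apply]
    rw [hj, mul_apply, ← em.sum_comp]
    simp [hrow, one_apply]
  · have hrank := congrArg rank hmain
    rw [rank_submatrix, rank_fromBlocks_zero_zero, rank_fromCols_one_zero, Fintype.card_fin,
      rank_mul_eq_left_of_isUnit_det _ _ (isUnit_det_of_left_inverse hUV'),
      rank_mul_eq_right_of_isUnit_det _ _ ((isUnit_iff_isUnit_det _).1 hPu), hb] at hrank
    omega
  · intro i j
    rw [hmain]
    obtain ⟨i, rfl⟩ := es.surjective i
    obtain ⟨j, rfl⟩ := em.surjective j
    have hes₁ (k) : (es (Sum.inl k)).1 = k.1 := rfl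
    have hes₂ (k) : (es (Sum.inr k)).1 = c_y + k.1 := rfl
    have hem₁ (k) : (em (Sum.inl (Sum.inl k))).1 = k.1 := rfl
    have hem₂ (k) : (em (Sum.inl (Sum.inr k))).1 = c_y + k.1 := rfl
    have hem₃ (k) : (em (Sum.inr k)).1 = c + k.1 := rfl
    rw [submatrix_apply, Equiv.symm_apply_apply, Equiv.symm_apply_apply]
    rcases i with i | i <;> rcases j with (j | j) | j
    · simp [hes₁, hem₁, one_apply, Fin.ext_iff]
    · have := i.isLt
      simp [hes₁, hem₂]
    · have := i.isLt
      have h : ¬ c + j.1 < c_y := by omega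
      simp [hes₁, hem₃, h]
    · have h : ¬ c ≤ j.1 := by omega
      simp [hes₂, hem₁, h]
    · have h : ¬ c ≤ c_y + j.1 := by omega
      simp [hes₂, hem₂, h]
    · simp [hes₂, hem₃]
end

section
/- Let b ∈ ℝ^{s×p} with rank(b) = n. Let (β_T)_{T∈ℕ} ⊂ ℝ^{s×p} satisfy ‖β_T − b‖_F → 0. Let (W^f_T) ⊂ ℝ^{s×s} and (W^p_T) ⊂ ℝ^{p×p} be sequences of invertible matrices converging to invertible matrices W^f and W^p respectively. For each T let C_T ∈ ℝ^{s×p} be a matrix of rank at most n that minimizes M ↦ ‖W^f_T (β_T − M) W^p_T‖_F over all matrices M ∈ ℝ^{s×p} of rank at most n. Then there is a constant K such that for all sufficiently large T, ‖C_T − b‖_F ≤ K · ‖β_T − b‖_F. -/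
open Filter Matrix Topology

/-- Frobenius norm of a real matrix. -/
noncomputable def frob {α β : Type*} [Fintype α] [Fintype β] (A : Matrix α β ℝ) : ℝ :=
  Real.sqrt (∑ i, ∑ j, (A i j) ^ 2)

attribute [local instance] Matrix.frobeniusNormedAddCommGroup

theorem frob_eq_norm {α β : Type*} [Fintype α] [Fintype β] (A : Matrix α β ℝ) :
    frob A = ‖A‖ := by
  simp [frob, Matrix.frobenius_norm_def, Real.sqrt_eq_rpow]

theorem frob_nonneg {α β : Type*} [Fintype α] [Fintype β] (A : Matrix α β ℝ) : 0 ≤ frob A :=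
  Real.sqrt_nonneg _

theorem frob_add_le {α β : Type*} [Fintype α] [Fintype β] (A B : Matrix α β ℝ) :
    frob (A + B) ≤ frob A + frob B := by
  simpa only [frob_eq_norm] using norm_add_le A B

theorem frob_sub_le {α β : Type*} [Fintype α] [Fintype β] (A B : Matrix α β ℝ) :
    frob (A - B) ≤ frob A + frob B := by
  simpa only [frob_eq_norm] using norm_sub_le A B

theorem frob_mul_le {α β γ : Type*} [Fintype α] [Fintype β] [Fintype γ]
    (A : Matrix α β ℝ) (B : Matrix β γ ℝ) : frob (A * B) ≤ frob A * frob B := by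
  simpa only [frob_eq_norm] using Matrix.frobenius_norm_mul A B

theorem frob_mul_mul_le {α β γ δ : Type*} [Fintype α] [Fintype β] [Fintype γ] [Fintype δ]
    (A : Matrix α β ℝ) (B : Matrix β γ ℝ) (C : Matrix γ δ ℝ) :
    frob (A * B * C) ≤ frob A * frob B * frob C :=
  (frob_mul_le _ _).trans (mul_le_mul_of_nonneg_right (frob_mul_le _ _) (frob_nonneg _))

/-- A convergent sequence of matrices is eventually bounded. -/
theorem eventually_frob_le {α β : Type*} [Fintype α] [Fintype β]
    {W : ℕ → Matrix α β ℝ} {L : Matrix α β ℝ}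
    (hW : Tendsto (fun T => frob (W T - L)) atTop (𝓝 0)) :
    ∀ᶠ T in atTop, frob (W T) ≤ 1 + frob L := by
  filter_upwards [hW.eventually_le_const one_pos] with T hT
  have h := frob_add_le (W T - L) L
  rw [sub_add_cancel] at h
  linarith

/-- The inverses of invertible matrices converging to an invertible matrix are eventually
bounded. -/
theorem eventually_frob_inv_le {α : Type*} [Fintype α] [DecidableEq α]
    {W : ℕ → Matrix α α ℝ} {L : Matrix α α ℝ} (hU : ∀ T, IsUnit (W T)) (hL : IsUnit L)
    (hW : Tendsto (fun T => frob (W T - L)) atTop (𝓝 0)) :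
    ∀ᶠ T in atTop, frob (W T)⁻¹ ≤ 2 * frob L⁻¹ := by
  have hlim : Tendsto (fun T => frob (W T - L) * frob L⁻¹) atTop (𝓝 0) := by
    simpa using hW.mul_const (frob L⁻¹)
  filter_upwards [hlim.eventually_le_const (show (0 : ℝ) < 1 / 2 by norm_num)] with T hT
  have h1 : (W T)⁻¹ * W T = 1 :=
    Matrix.nonsing_inv_mul _ ((Matrix.isUnit_iff_isUnit_det _).mp (hU T))
  have h2 : L * L⁻¹ = 1 := Matrix.mul_nonsing_inv _ ((Matrix.isUnit_iff_isUnit_det _).mp hL)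
  have key : (W T)⁻¹ = L⁻¹ - (W T)⁻¹ * (W T - L) * L⁻¹ := by
    rw [mul_sub, h1, sub_mul, one_mul, mul_assoc, h2, mul_one, sub_sub_cancel]
  have h3 := frob_sub_le L⁻¹ ((W T)⁻¹ * (W T - L) * L⁻¹)
  rw [← key] at h3
  have h4 := frob_mul_mul_le (W T)⁻¹ (W T - L) L⁻¹
  rw [mul_assoc (frob _)] at h4
  have h5 := mul_le_mul_of_nonneg_left hT (frob_nonneg (W T)⁻¹)
  linarith

/-- consistency of the best weighted rank-`n` approximation
(first step of Lemma 3 of the paper).  If `β T → b` (rank of `b` is `n`), the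
invertible weights converge to invertible limits, and `C T` minimizes the
weighted Frobenius distance to `β T` over matrices of rank at most `n`, then
`‖C T − b‖_F ≤ K ‖β T − b‖_F` eventually, for some constant `K`. -/
theorem stmt1 (s p n : ℕ)
    (b : Matrix (Fin s) (Fin p) ℝ) (hb : b.rank = n)
    (β : ℕ → Matrix (Fin s) (Fin p) ℝ)
    (hβ : Tendsto (fun T => frob (β T - b)) atTop (𝓝 0))
    (Wf : ℕ → Matrix (Fin s) (Fin s) ℝ) (Wp : ℕ → Matrix (Fin p) (Fin p) ℝ)
    (WfL : Matrix (Fin s) (Fin s) ℝ) (WpL : Matrix (Fin p) (Fin p) ℝ)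
    (hWfU : ∀ T, IsUnit (Wf T)) (hWpU : ∀ T, IsUnit (Wp T))
    (hWfL : IsUnit WfL) (hWpL : IsUnit WpL)
    (hWf : Tendsto (fun T => frob (Wf T - WfL)) atTop (𝓝 0))
    (hWp : Tendsto (fun T => frob (Wp T - WpL)) atTop (𝓝 0))
    (C : ℕ → Matrix (Fin s) (Fin p) ℝ)
    (hCrank : ∀ T, (C T).rank ≤ n)
    (hCmin : ∀ T, ∀ M : Matrix (Fin s) (Fin p) ℝ, M.rank ≤ n →
      frob (Wf T * (β T - C T) * Wp T) ≤ frob (Wf T * (β T - M) * Wp T)) :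
    ∃ K : ℝ, ∀ᶠ T in atTop, frob (C T - b) ≤ K * frob (β T - b) := by
  refine ⟨2 * frob WfL⁻¹ * ((1 + frob WfL) * (1 + frob WpL)) * (2 * frob WpL⁻¹) + 1, ?_⟩
  filter_upwards [eventually_frob_le hWf, eventually_frob_le hWp,
    eventually_frob_inv_le hWfU hWfL hWf, eventually_frob_inv_le hWpU hWpL hWp]
    with T hf hp hf' hp'
  have h1 : (Wf T)⁻¹ * Wf T = 1 :=
    Matrix.nonsing_inv_mul _ ((Matrix.isUnit_iff_isUnit_det _).mp (hWfU T))
  have h2 : Wp T * (Wp T)⁻¹ = 1 :=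
    Matrix.mul_nonsing_inv _ ((Matrix.isUnit_iff_isUnit_det _).mp (hWpU T))
  have hrec : β T - C T = (Wf T)⁻¹ * (Wf T * (β T - C T) * Wp T) * (Wp T)⁻¹ := by
    rw [Matrix.mul_assoc (Wf T), ← Matrix.mul_assoc (Wf T)⁻¹, h1, Matrix.one_mul,
      Matrix.mul_assoc, h2, Matrix.mul_one]
  have hL0 := frob_nonneg WfL
  have hL1 := frob_nonneg WfL⁻¹
  have hb0 := frob_nonneg (β T - b)
  have hweighted : frob (Wf T * (β T - C T) * Wp T)
      ≤ (1 + frob WfL) * frob (β T - b) * (1 + frob WpL) := by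
    refine (hCmin T b hb.le).trans ((frob_mul_mul_le _ _ _).trans ?_)
    have := frob_nonneg (Wp T)
    gcongr
  have hdist : frob (β T - C T) ≤
      2 * frob WfL⁻¹ * ((1 + frob WfL) * frob (β T - b) * (1 + frob WpL)) *
        (2 * frob WpL⁻¹) := by
    rw [hrec]
    refine (frob_mul_mul_le _ _ _).trans ?_
    have := frob_nonneg (Wp T)⁻¹
    have := frob_nonneg (Wf T * (β T - C T) * Wp T)
    have := frob_nonneg WpL
    gcongr
  have htri := frob_sub_le (β T - b) (β T - C T)
  rw [sub_sub_sub_cancel_left] at htri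
  linarith
end

section
/- Let Q, M, Φ, Ψ ∈ ℝ^{m×m}, G, Γ ∈ ℝ^{m×n} and R², Θ² ∈ ℝ^{n×n} satisfy Q·G = M·G·R² and Φ·Γ = Ψ·Γ·Θ². Set J := Q − Φ, Δ := M − Ψ and ΔG := G − Γ, and assume ΓᵀΨΓ is invertible, with Γ† := (ΓᵀΨΓ)⁻¹Γᵀ. Then R² − Θ² = Γ†·(Φ·ΔG − Ψ·ΔG·R² − Δ·G·R² + J·G). -/
open Matrix

/-- the exact identity (singval) from the proof of Lemma 5(II) of
the paper, expressing the perturbation of the squared generalized singular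
values, with `Γ† = (ΓᵀΨΓ)⁻¹Γᵀ`, `J = Q − Φ`, `Δ = M − Ψ`, `ΔG = G − Γ`. -/
theorem stmt6 (m n : ℕ) (Q M Φ Ψ : Matrix (Fin m) (Fin m) ℝ)
    (G Γ : Matrix (Fin m) (Fin n) ℝ) (R2 Θ2 : Matrix (Fin n) (Fin n) ℝ)
    (h1 : Q * G = M * G * R2) (h2 : Φ * Γ = Ψ * Γ * Θ2)
    (hU : IsUnit (Γᵀ * Ψ * Γ)) :
    R2 - Θ2 = ((Γᵀ * Ψ * Γ)⁻¹ * Γᵀ) *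
      (Φ * (G - Γ) - Ψ * (G - Γ) * R2 - (M - Ψ) * G * R2 + (Q - Φ) * G) := by
  have key : Φ * (G - Γ) - Ψ * (G - Γ) * R2 - (M - Ψ) * G * R2 + (Q - Φ) * G
      = Ψ * Γ * (R2 - Θ2) := by
    simp only [Matrix.mul_sub, Matrix.sub_mul, h1, h2]
    abel
  rw [key, Matrix.mul_assoc, ← Matrix.mul_assoc Γᵀ, ← Matrix.mul_assoc Γᵀ,
    Matrix.nonsing_inv_mul_cancel_left _ _ ((Matrix.isUnit_iff_isUnit_det _).mp hU)]
end

section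
/- Let Q, M, Φ, Ψ ∈ ℝ^{m×m}, G, Γ ∈ ℝ^{m×n} and R², Θ² ∈ ℝ^{n×n} satisfy Q·G = M·G·R² and Φ·Γ = Ψ·Γ·Θ². Set J := Q − Φ, Δ := M − Ψ and ΔG := G − Γ, and assume ΓᵀΨΓ is invertible, with Γ† := (ΓᵀΨΓ)⁻¹Γᵀ. Then (I_m − Ψ·Γ·Γ†)·Ψ·ΔG·R² = (I_m − Ψ·Γ·Γ†)·(J·G − Δ·G·R² + Φ·ΔG). -/
open Matrix

/-- The oblique projector `1 - ΨΓ(ΓᵀΨΓ)⁻¹Γᵀ` annihilates `ΨΓ`. -/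
theorem one_sub_oblique_mul_eq_zero {m n R : Type*} [Fintype m] [DecidableEq m] [Fintype n]
    [DecidableEq n] [CommRing R] (Ψ : Matrix m m R) (Γ : Matrix m n R)
    (hU : IsUnit (Γᵀ * Ψ * Γ)) :
    (1 - Ψ * Γ * ((Γᵀ * Ψ * Γ)⁻¹ * Γᵀ)) * (Ψ * Γ) = 0 := by
  have hdet : IsUnit (Γᵀ * Ψ * Γ).det := (Matrix.isUnit_iff_isUnit_det _).mp hU
  rw [Matrix.sub_mul, Matrix.one_mul, Matrix.mul_assoc (Ψ * Γ), Matrix.mul_assoc _ Γᵀ,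
    ← Matrix.mul_assoc Γᵀ, Matrix.nonsing_inv_mul _ hdet, Matrix.mul_one, sub_self]

/-- the exact identity (imgg) of Lemma 5(II) of the paper,
obtained by projecting the perturbation equation of the generalized eigenvalue
problem with the oblique projector `I − ΨΓΓ†` (which annihilates `ΨΓ`), where
`Γ† = (ΓᵀΨΓ)⁻¹Γᵀ`, `J = Q − Φ`, `Δ = M − Ψ`, `ΔG = G − Γ`. -/
theorem stmt7 (m n : ℕ) (Q M Φ Ψ : Matrix (Fin m) (Fin m) ℝ)
    (G Γ : Matrix (Fin m) (Fin n) ℝ) (R2 Θ2 : Matrix (Fin n) (Fin n) ℝ)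
    (h1 : Q * G = M * G * R2) (h2 : Φ * Γ = Ψ * Γ * Θ2)
    (hU : IsUnit (Γᵀ * Ψ * Γ)) :
    (1 - Ψ * Γ * ((Γᵀ * Ψ * Γ)⁻¹ * Γᵀ)) * (Ψ * (G - Γ) * R2) =
      (1 - Ψ * Γ * ((Γᵀ * Ψ * Γ)⁻¹ * Γᵀ)) *
        ((Q - Φ) * G - (M - Ψ) * G * R2 + Φ * (G - Γ)) := by
  have hP : (1 - Ψ * Γ * ((Γᵀ * Ψ * Γ)⁻¹ * Γᵀ)) * (Ψ * Γ) = 0 :=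
    one_sub_oblique_mul_eq_zero Ψ Γ hU
  have hR : (Q - Φ) * G - (M - Ψ) * G * R2 + Φ * (G - Γ) =
      Ψ * (G - Γ) * R2 + Ψ * Γ * (R2 - Θ2) := by
    simp only [Matrix.sub_mul, Matrix.mul_sub, h1, h2]
    abel
  rw [hR, Matrix.mul_add, ← Matrix.mul_assoc _ (Ψ * Γ) (R2 - Θ2), hP, Matrix.zero_mul, add_zero]
end

section
/- Let O ∈ ℝ^{s×n}, G ∈ ℝ^{p×n}, let S_p ∈ ℝ^{p×n} be a selector matrix with Gᵀ S_p = I_n, let L ∈ ℝ^{n×s} and δ ∈ ℝ^{s×p}, and set β := O·Gᵀ + δ. Assume M := L·O + L·δ·S_p is invertible and define G̃ᵀ := M⁻¹·L·β. Then G̃ᵀ·S_p = I_n and G̃ᵀ − Gᵀ = M⁻¹·L·δ·(I_p − S_p·Gᵀ). -/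
open Matrix

/-- A selector matrix: its columns are distinct columns of the identity matrix. -/
def IsSelector {p n : ℕ} (S : Matrix (Fin p) (Fin n) ℝ) : Prop :=
  ∃ f : Fin n → Fin p, Function.Injective f ∧ ∀ i j, S i j = if i = f j then 1 else 0

/-- the exact matrix identity underlying the key step of the
consistency proof of Theorem 2 of the paper: the normalized right factor
extracted from `β = OGᵀ + δ` via an approximate left inverse `L` differs from
the true `Gᵀ` by `M⁻¹ L δ (I − S_p Gᵀ)`, with `M = LO + LδS_p`. -/
theorem stmt10 (s p n : ℕ)
    (O : Matrix (Fin s) (Fin n) ℝ) (G Sp : Matrix (Fin p) (Fin n) ℝ)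
    (hSp : IsSelector Sp) (hGS : Gᵀ * Sp = 1)
    (L : Matrix (Fin n) (Fin s) ℝ) (δ : Matrix (Fin s) (Fin p) ℝ)
    (β : Matrix (Fin s) (Fin p) ℝ) (hβ : β = O * Gᵀ + δ)
    (hM : IsUnit (L * O + L * δ * Sp)) :
    ((L * O + L * δ * Sp)⁻¹ * L * β) * Sp = 1 ∧
    (L * O + L * δ * Sp)⁻¹ * L * β - Gᵀ =
      (L * O + L * δ * Sp)⁻¹ * L * δ * (1 - Sp * Gᵀ) := by
  have hdet := (Matrix.isUnit_iff_isUnit_det _).mp hM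
  have hβS : L * β * Sp = L * O + L * δ * Sp := by
    rw [hβ, Matrix.mul_add, Matrix.add_mul, ← Matrix.mul_assoc L O, Matrix.mul_assoc (L * O),
      hGS, Matrix.mul_one]
  have hβG : L * β - (L * O + L * δ * Sp) * Gᵀ = L * δ * (1 - Sp * Gᵀ) := by
    rw [hβ, Matrix.mul_add, Matrix.add_mul, Matrix.mul_sub, Matrix.mul_one,
      ← Matrix.mul_assoc L O, ← Matrix.mul_assoc (L * δ)]
    abel
  constructor
  · rw [Matrix.mul_assoc _ L β, Matrix.mul_assoc, hβS, Matrix.nonsing_inv_mul _ hdet]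
  · rw [Matrix.mul_assoc _ L δ, Matrix.mul_assoc _ (L * δ), ← hβG, Matrix.mul_sub,
      Matrix.nonsing_inv_mul_cancel_left _ _ hdet, ← Matrix.mul_assoc _ L β]
end

section
/- Let (ε_t)_{t≥1} be a sequence of vectors in ℝ^k and let (C_j)_{j≥0} be matrices in ℝ^{d×k} such that Σ_{j=0}^∞ ‖C_j‖ and Σ_{j=0}^∞ j·‖C_j‖ both converge. Define c(1) := Σ_{j=0}^∞ C_j and, for i ≥ 0, C*_i := −Σ_{j=i+1}^∞ C_j (both sums converge absolutely). For t ≥ 1 set x_t := Σ_{j=1}^{t−1} ε_j (so x_1 = 0) and n_t := Σ_{j=0}^{t−1} C_j · x_{t−j}. Then for every t ≥ 1, n_t − c(1)·x_t = Σ_{k=1}^{t−1} C*_{t−1−k} · ε_k. -/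
open Matrix

theorem abs_apply_le_frob {α β : Type*} [Fintype α] [Fintype β] (A : Matrix α β ℝ)
    (i : α) (j : β) : |A i j| ≤ frob A := by
  refine Real.abs_le_sqrt ?_
  calc (A i j) ^ 2 ≤ ∑ j', (A i j') ^ 2 :=
        Finset.single_le_sum (f := fun j' => (A i j') ^ 2)
          (fun _ _ => sq_nonneg _) (Finset.mem_univ j)
    _ ≤ ∑ i', ∑ j', (A i' j') ^ 2 :=
        Finset.single_le_sum (f := fun i' => ∑ j', (A i' j') ^ 2)
          (fun _ _ => Finset.sum_nonneg fun _ _ => sq_nonneg _) (Finset.mem_univ i)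

theorem summable_of_summable_frob {ι α β : Type*} [Fintype α] [Fintype β]
    {C : ι → Matrix α β ℝ} (h : Summable fun n => frob (C n)) : Summable C :=
  Pi.summable.2 fun i => Pi.summable.2 fun j =>
    Summable.of_norm_bounded h fun n => abs_apply_le_frob (C n) i j

/-- Interchanging the lag sum with the partial sums of the increments. -/
theorem sum_range_mulVec_sum_Ico {R α β : Type*} [NonUnitalNonAssocSemiring R] [Fintype β]
    (C : ℕ → Matrix α β R) (ε : ℕ → β → R) (t : ℕ) :
    ∑ j ∈ Finset.range t, C j *ᵥ (∑ m ∈ Finset.Ico 1 (t - j), ε m) =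
      ∑ m ∈ Finset.Ico 1 t, (∑ j ∈ Finset.range (t - m), C j) *ᵥ ε m := by
  simp only [Matrix.mulVec_sum, Matrix.sum_mulVec]
  refine Finset.sum_comm' fun j m => ?_
  simp only [Finset.mem_range, Finset.mem_Ico]
  omega

/-- the exact finite-sample Beveridge–Nelson-type decomposition
from the proof of Lemma 1(I) of the paper: with `x_t = Σ_{j=1}^{t−1} ε_j`,
`n_t = Σ_{j=0}^{t−1} C_j x_{t−j}`, `c(1) = Σ_{j=0}^∞ C_j` and
`C*_i = −Σ_{j=i+1}^∞ C_j`, one has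
`n_t − c(1) x_t = Σ_{k=1}^{t−1} C*_{t−1−k} ε_k` for every `t ≥ 1`. -/
theorem stmt12 (k d : ℕ) (ε : ℕ → Fin k → ℝ) (C : ℕ → Matrix (Fin d) (Fin k) ℝ)
    (h1 : Summable (fun j : ℕ => frob (C j)))
    (h2 : Summable (fun j : ℕ => (j : ℝ) * frob (C j)))
    (x : ℕ → Fin k → ℝ) (hx : ∀ t, x t = ∑ j ∈ Finset.Ico 1 t, ε j)
    (nt : ℕ → Fin d → ℝ)
    (hn : ∀ t, nt t = ∑ j ∈ Finset.range t, (C j).mulVec (x (t - j))) :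
    ∀ t, 1 ≤ t →
      nt t - (∑' j, C j).mulVec (x t) =
        ∑ k' ∈ Finset.Ico 1 t, (-(∑' j, C ((t - 1 - k') + 1 + j))).mulVec (ε k') := by
  intro t _
  have hC := summable_of_summable_frob h1
  simp only [hn, hx]
  rw [sum_range_mulVec_sum_Ico, Matrix.mulVec_sum, ← Finset.sum_sub_distrib]
  refine Finset.sum_congr rfl fun m hm => ?_
  have hm' : t - 1 - m + 1 = t - m := by
    have := Finset.mem_Ico.1 hm
    omega
  rw [← Matrix.sub_mulVec, ← hC.sum_add_tsum_nat_add (t - m), hm', sub_add_cancel_left]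
  simp only [add_comm]
end

section
/- Let Z ∈ ℝ^{m×m}, C ∈ ℝ^{m×q}, Y ∈ ℝ^{q×q} invertible, Γ ∈ ℝ^{m×n} and Θ² ∈ ℝ^{n×n} satisfy the generalized eigenvalue relation Z·Γ·Θ² = C·Y⁻¹·Cᵀ·Γ. Assume Z − C·Y⁻¹·Cᵀ is invertible, with inverse S, and that I_n − Θ² is invertible. Then S·Z·Γ = Γ·(I_n − Θ²)⁻¹. -/
open Matrix

/-- the exact matrix identity (equ:convS) of Lemma 8 of the
paper: if `ZΓΘ² = CY⁻¹CᵀΓ`, `S = (Z − CY⁻¹Cᵀ)⁻¹` exists and `I − Θ²` is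
invertible, then `SZΓ = Γ(I − Θ²)⁻¹`. -/
theorem stmt15 (m q n : ℕ)
    (Z : Matrix (Fin m) (Fin m) ℝ) (C : Matrix (Fin m) (Fin q) ℝ)
    (Y : Matrix (Fin q) (Fin q) ℝ) (hY : IsUnit Y)
    (Γ : Matrix (Fin m) (Fin n) ℝ) (Θ2 : Matrix (Fin n) (Fin n) ℝ)
    (heig : Z * Γ * Θ2 = C * Y⁻¹ * Cᵀ * Γ)
    (hS : IsUnit (Z - C * Y⁻¹ * Cᵀ))
    (hΘ : IsUnit ((1 : Matrix (Fin n) (Fin n) ℝ) - Θ2)) :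
    (Z - C * Y⁻¹ * Cᵀ)⁻¹ * Z * Γ = Γ * ((1 : Matrix (Fin n) (Fin n) ℝ) - Θ2)⁻¹ := by
  have hSdet := (isUnit_iff_isUnit_det _).mp hS
  have hΘdet := (isUnit_iff_isUnit_det _).mp hΘ
  have key : (Z - C * Y⁻¹ * Cᵀ) * Γ = Z * Γ * (1 - Θ2) := by
    rw [Matrix.sub_mul, Matrix.mul_sub, Matrix.mul_one, heig]
  calc (Z - C * Y⁻¹ * Cᵀ)⁻¹ * Z * Γ
      = (Z - C * Y⁻¹ * Cᵀ)⁻¹ * (Z * Γ * (1 - Θ2) * (1 - Θ2)⁻¹) := by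
        rw [mul_nonsing_inv_cancel_right _ _ hΘdet, Matrix.mul_assoc]
    _ = Γ * (1 - Θ2)⁻¹ := by
        rw [← key, Matrix.mul_assoc _ Γ, nonsing_inv_mul_cancel_left _ _ hSdet]
end

section
/- Let Y ∈ ℝ^{s×m}, let Z ∈ ℝ^{m×m} be symmetric positive definite with a symmetric invertible square root W_p (i.e. W_p = W_pᵀ, W_p² = Z), and let W_f ∈ ℝ^{s×s} be invertible. Suppose W_f · (Y·Z⁻¹) · W_p = Û·Ŝ·V̂ᵀ + R̂ where V̂ ∈ ℝ^{m×n} satisfies V̂ᵀV̂ = I_n and R̂·V̂ = 0 (as holds for a truncated singular value decomposition). Define K̂ := W_p⁻¹·V̂ and Ô := W_f⁻¹·Û·Ŝ. Then K̂ᵀ·Z·K̂ = I_n and Y·K̂·(K̂ᵀ·Z·K̂)⁻¹ = Ô; in particular, with Y = ⟨y_t, z_t⟩ and Z = ⟨z_t, z_t⟩ for data vectors (y_t) and (z_t), Ô equals the OLS coefficient of regressing y_t on K̂ᵀz_t. -/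
open Matrix

/-- Empirical second-moment matrix `⟨a_t, b_t⟩ = T⁻¹ Σ_t a_t b_tᵀ`. -/
noncomputable def corr {T : ℕ} {α β : Type*} [Fintype α] [Fintype β]
    (a : Fin T → α → ℝ) (b : Fin T → β → ℝ) : Matrix α β ℝ :=
  (T : ℝ)⁻¹ • ∑ t, Matrix.vecMulVec (a t) (b t)

theorem corr_mulVec_right {T : ℕ} {α β γ : Type*} [Fintype α] [Fintype β] [Fintype γ]
    (a : Fin T → α → ℝ) (b : Fin T → β → ℝ) (M : Matrix γ β ℝ) :
    corr a (fun t => M *ᵥ b t) = corr a b * Mᵀ := by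
  simp only [corr, Matrix.smul_mul, Matrix.sum_mul, Matrix.vecMulVec_mul, Matrix.vecMul_transpose]

theorem corr_mulVec_left {T : ℕ} {α β γ : Type*} [Fintype α] [Fintype β] [Fintype γ]
    (a : Fin T → α → ℝ) (b : Fin T → β → ℝ) (M : Matrix γ α ℝ) :
    corr (fun t => M *ᵥ a t) b = M * corr a b := by
  simp only [corr, Matrix.mul_smul, Matrix.mul_sum, Matrix.mul_vecMulVec]

/-- the claim from Section 2 of the paper.  If
`W_f (Y Z⁻¹) W_p = Û Ŝ V̂ᵀ + R̂` with `V̂ᵀV̂ = I`, `R̂V̂ = 0`, `W_p` a symmetric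
invertible square root of the symmetric positive definite `Z`, and `W_f`
invertible, then `K̂ = W_p⁻¹V̂` satisfies `K̂ᵀZK̂ = I` and
`Y K̂ (K̂ᵀZK̂)⁻¹ = Ô := W_f⁻¹ÛŜ`; in particular, with `Y = ⟨y,z⟩` and
`Z = ⟨z,z⟩`, `Ô` is the OLS coefficient of regressing `y_t` on `K̂ᵀz_t`. -/
theorem stmt19 (s m n : ℕ)
    (Y : Matrix (Fin s) (Fin m) ℝ) (Z Wp : Matrix (Fin m) (Fin m) ℝ)
    (hZ : Z.PosDef) (hWpsym : Wpᵀ = Wp) (hWpsq : Wp * Wp = Z) (hWpU : IsUnit Wp)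
    (Wf : Matrix (Fin s) (Fin s) ℝ) (hWf : IsUnit Wf)
    (U : Matrix (Fin s) (Fin n) ℝ) (S : Matrix (Fin n) (Fin n) ℝ)
    (V : Matrix (Fin m) (Fin n) ℝ) (R : Matrix (Fin s) (Fin m) ℝ)
    (hV : Vᵀ * V = 1) (hRV : R * V = 0)
    (hSVD : Wf * (Y * Z⁻¹) * Wp = U * S * Vᵀ + R) :
    (Wp⁻¹ * V)ᵀ * Z * (Wp⁻¹ * V) = 1 ∧
    Y * (Wp⁻¹ * V) * ((Wp⁻¹ * V)ᵀ * Z * (Wp⁻¹ * V))⁻¹ = Wf⁻¹ * U * S ∧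
    ∀ (T : ℕ) (yd : Fin T → Fin s → ℝ) (zd : Fin T → Fin m → ℝ),
      Y = corr yd zd → Z = corr zd zd →
      corr yd (fun t => (Wp⁻¹ * V)ᵀ.mulVec (zd t)) *
        (corr (fun t => (Wp⁻¹ * V)ᵀ.mulVec (zd t))
          (fun t => (Wp⁻¹ * V)ᵀ.mulVec (zd t)))⁻¹ = Wf⁻¹ * U * S := by
  have hdet := (Matrix.isUnit_iff_isUnit_det _).1 hWpU
  have hfdet := (Matrix.isUnit_iff_isUnit_det _).1 hWf
  have hinv : Z⁻¹ * Wp = Wp⁻¹ := by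
    rw [← hWpsq, Matrix.mul_inv_rev, Matrix.mul_assoc, Matrix.nonsing_inv_mul _ hdet,
      Matrix.mul_one]
  have hnorm : (Wp⁻¹ * V)ᵀ * Z * (Wp⁻¹ * V) = 1 := by
    calc (Wp⁻¹ * V)ᵀ * Z * (Wp⁻¹ * V)
        = Vᵀ * ((Wp⁻¹ * Wp) * (Wp * Wp⁻¹)) * V := by
          rw [Matrix.transpose_mul, Matrix.transpose_nonsing_inv, hWpsym, ← hWpsq]
          simp only [Matrix.mul_assoc]
      _ = 1 := by
          rw [Matrix.nonsing_inv_mul _ hdet, Matrix.mul_nonsing_inv _ hdet, Matrix.mul_one,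
            Matrix.mul_one, hV]
  have hcoef : Y * (Wp⁻¹ * V) = Wf⁻¹ * U * S := by
    calc Y * (Wp⁻¹ * V)
        = Wf⁻¹ * Wf * (Y * (Z⁻¹ * Wp)) * V := by
          rw [Matrix.nonsing_inv_mul _ hfdet, Matrix.one_mul, hinv, Matrix.mul_assoc]
      _ = Wf⁻¹ * (Wf * (Y * Z⁻¹) * Wp) * V := by simp only [Matrix.mul_assoc]
      _ = Wf⁻¹ * (U * S * (Vᵀ * V) + R * V) := by
          rw [hSVD, Matrix.mul_assoc, Matrix.add_mul, Matrix.mul_assoc (U * S)]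
      _ = Wf⁻¹ * U * S := by
          rw [hV, hRV, Matrix.mul_one, add_zero, Matrix.mul_assoc]
  have hols : Y * (Wp⁻¹ * V) * ((Wp⁻¹ * V)ᵀ * Z * (Wp⁻¹ * V))⁻¹ = Wf⁻¹ * U * S := by
    rw [hnorm, inv_one, Matrix.mul_one, hcoef]
  refine ⟨hnorm, hols, fun T yd zd hY hZ' => ?_⟩
  rw [corr_mulVec_right, corr_mulVec_right, corr_mulVec_left, ← hY, ← hZ',
    Matrix.transpose_transpose, hols]
end
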